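/- Let P be a penny configuration in general position and let A ∈ P have degree exactly 4, and suppose A does not belong to any apricot. Then it is impossible that every unit-neighbor B of A satisfies the following (edge AB of Type II): B has degree 5, B is popular, and the five unit-neighbors of B, listed in cyclic angular order around B (in a suitable rotational direction) as C₁, C₂, C₃, C₄, C₅ with C₅ = A, satisfy dist(C₁,C₂) = dist(C₃,C₄) = dist(C₄,A) = 1. -/

import Mathlib

open Real EuclideanGeometry

/-- The Euclidean plane. -/
abbrev Pt := EuclideanSpace ℝ (Fin 2)

/-- A penny configuration in general position: a finite set of points in the plane
such that any two distinct points are at distance at least 1 and no three points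
are collinear. -/
def PennyGP (P : Finset Pt) : Prop :=
  (∀ p ∈ P, ∀ q ∈ P, p ≠ q → 1 ≤ dist p q) ∧
  (∀ p ∈ P, ∀ q ∈ P, ∀ r ∈ P, p ≠ q → p ≠ r → q ≠ r →
    ¬ Collinear ℝ ({p, q, r} : Set Pt))

/-- The degree of a point `A` in the penny graph of `P`: the number of points of `P`
at distance exactly 1 from `A`. -/
noncomputable def deg (P : Finset Pt) (A : Pt) : ℕ :=
  {q : Pt | q ∈ P ∧ dist A q = 1}.ncard

/-- A kernel: four distinct points of `P`, each of degree 5, with the five unit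
distances `LU`, `UR`, `RD`, `DL`, `LR`. -/
def IsKernel (P : Finset Pt) (L U R D : Pt) : Prop :=
  L ∈ P ∧ U ∈ P ∧ R ∈ P ∧ D ∈ P ∧
  List.Pairwise (· ≠ ·) [L, U, R, D] ∧
  deg P L = 5 ∧ deg P U = 5 ∧ deg P R = 5 ∧ deg P D = 5 ∧
  dist L U = 1 ∧ dist U R = 1 ∧ dist R D = 1 ∧ dist D L = 1 ∧ dist L R = 1

/-- A point belongs to a kernel if it is one of the four points of some kernel of `P`. -/
def InKernel (P : Finset Pt) (X : Pt) : Prop :=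
  ∃ L U R D : Pt, IsKernel P L U R D ∧ X ∈ ({L, U, R, D} : Set Pt)

/-- A point `X ∈ P` belongs to an apricot if there is a kernel `{L, U, R, D}` of `P`
with `X` outside the kernel and at unit distance from at least one kernel point. -/
def InApricot (P : Finset Pt) (X : Pt) : Prop :=
  ∃ L U R D : Pt, IsKernel P L U R D ∧ X ∉ ({L, U, R, D} : Set Pt) ∧
    (dist X L = 1 ∨ dist X U = 1 ∨ dist X R = 1 ∨ dist X D = 1)

/-- A point `B ∈ P` is unpopular if `deg B ≤ 4`, or `deg B = 5` and some
unit-neighbor of `B` has degree at most 3, or `deg B = 5` and at least two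
unit-neighbors of `B` have degree 4. Otherwise it is popular. -/
def Unpopular (P : Finset Pt) (B : Pt) : Prop :=
  deg P B ≤ 4 ∨
  (deg P B = 5 ∧ ∃ C ∈ P, dist B C = 1 ∧ deg P C ≤ 3) ∨
  (deg P B = 5 ∧ ∃ C ∈ P, ∃ C' ∈ P, C ≠ C' ∧ dist B C = 1 ∧ dist B C' = 1 ∧
    deg P C = 4 ∧ deg P C' = 4)

/-- The points of the list `ws` occur in this exact cyclic angular order around `X`,
in the counterclockwise direction: each point lies on a ray from `X` at angle `θ i`,
where the angles are strictly increasing and all lie within one turn. (The cyclic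
angular order of points around `X` in a given rotational direction is witnessed by
such a list of angles, cut at an arbitrary reference ray.) -/
def AngOrder (X : Pt) (ws : List Pt) : Prop :=
  ∃ θ : Fin ws.length → ℝ, ∃ r : Fin ws.length → ℝ,
    (∀ i, 0 < r i) ∧ StrictMono θ ∧
    (∀ i j : Fin ws.length, θ j - θ i < 2 * π) ∧
    ∀ i : Fin ws.length,
      ws.get i = X + r i • (EuclideanSpace.equiv (Fin 2) ℝ).symm
        ![Real.cos (θ i), Real.sin (θ i)]

/-- The unit vector at angle `θ`. -/
noncomputable def dir (θ : ℝ) : Pt :=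
  (EuclideanSpace.equiv (Fin 2) ℝ).symm ![Real.cos θ, Real.sin θ]

@[simp] lemma dir_zero_coord (θ : ℝ) : dir θ 0 = Real.cos θ := rfl

@[simp] lemma dir_one_coord (θ : ℝ) : dir θ 1 = Real.sin θ := rfl

lemma Pt.ext' {p q : Pt} (h0 : p 0 = q 0) (h1 : p 1 = q 1) : p = q := by
  ext i; fin_cases i <;> assumption

lemma Pt.norm_sq (p : Pt) : ‖p‖ ^ 2 = p 0 ^ 2 + p 1 ^ 2 := by
  rw [EuclideanSpace.real_norm_sq_eq, Fin.sum_univ_two]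

lemma inner_dir (x y : ℝ) : inner ℝ (dir x) (dir y) = Real.cos (x - y) := by
  rw [PiLp.inner_apply, Fin.sum_univ_two, Real.cos_sub]
  simp; ring

@[simp] lemma norm_dir (x : ℝ) : ‖dir x‖ = 1 := by
  have h : ‖dir x‖ ^ 2 = 1 := by rw [← real_inner_self_eq_norm_sq, inner_dir]; simp
  nlinarith [norm_nonneg (dir x)]

lemma dir_add_pi (x : ℝ) : dir (x + π) = -dir x := by
  apply Pt.ext' <;> simp

lemma dir_sub_pi (x : ℝ) : dir (x - π) = -dir x := by
  apply Pt.ext' <;> simp [Real.cos_sub_pi, Real.sin_sub_pi]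

lemma dir_add_two_pi (x : ℝ) : dir (x + 2 * π) = dir x := by
  apply Pt.ext' <;> simp

lemma dir_add_dir_third (x : ℝ) : dir (x + π / 3) + dir (x - π / 3) = dir x := by
  apply Pt.ext' <;> simp [Real.cos_add, Real.sin_add, Real.cos_sub, Real.sin_sub] <;> ring

lemma dir_sub_dir (x y : ℝ) :
    dir x - dir y = (2 * Real.sin ((y - x) / 2)) • dir ((x + y) / 2 - π / 2) := by
  apply Pt.ext'
  · simp [Real.cos_sub_pi_div_two, Real.cos_sub_cos]
    rw [show (y - x) / 2 = -((x - y) / 2) by ring, Real.sin_neg]; ring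
  · simp [Real.sin_sub_pi_div_two, Real.sin_sub_sin]
    rw [show (y - x) / 2 = -((x - y) / 2) by ring, Real.sin_neg]; ring

lemma dir_add_dir (x y : ℝ) :
    dir x + dir y = (2 * Real.cos ((x - y) / 2)) • dir ((x + y) / 2) := by
  apply Pt.ext'
  · simp [Real.cos_add_cos]; ring
  · simp [Real.sin_add_sin]; ring

lemma dir_eq_iff {x y : ℝ} : dir x = dir y ↔ ∃ k : ℤ, x = y + k * (2 * π) := by
  constructor
  · intro h
    have hc : Real.cos (x - y) = 1 := by
      rw [← inner_dir, h, inner_dir]; simp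
    obtain ⟨k, hk⟩ := (Real.cos_eq_one_iff _).1 hc
    exact ⟨k, by linarith⟩
  · rintro ⟨k, rfl⟩
    apply Pt.ext' <;> simp

lemma dir_add_congr {x y : ℝ} (h : dir x = dir y) (z : ℝ) : dir (x + z) = dir (y + z) := by
  rw [dir_eq_iff] at h ⊢
  obtain ⟨k, hk⟩ := h
  exact ⟨k, by rw [hk]; ring⟩

lemma eq_of_dir_eq {φ σ x y : ℝ} (hσ : σ = 1 ∨ σ = -1) (h : dir (φ + σ * x) = dir (φ + σ * y))
    (h1 : x < y + 2 * π) (h2 : y < x + 2 * π) : x = y := by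
  obtain ⟨k, hk⟩ := dir_eq_iff.1 h
  have hpi := Real.pi_pos
  have key : σ * (x - y) = k * (2 * π) := by linarith
  have hk0 : k = 0 := by
    have h3 : |(k : ℝ)| * (2 * π) < 1 * (2 * π) := by
      rw [← abs_of_pos (show (0:ℝ) < 2 * π by positivity), ← abs_mul,
        ← key, abs_of_pos (show (0:ℝ) < 2 * π by positivity), abs_lt]
      rcases hσ with rfl | rfl <;> constructor <;> linarith
    have h4 : |(k : ℝ)| < 1 := lt_of_mul_lt_mul_right h3 (by positivity)
    have h5 : |k| < 1 := by exact_mod_cast h4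
    exact Int.abs_lt_one_iff.1 h5
  rw [hk0] at key
  rcases hσ with rfl | rfl <;> simp at key <;> linarith

lemma exists_dir {v : Pt} (hv : ‖v‖ = 1) {φ σ : ℝ} (hσ : σ = 1 ∨ σ = -1) :
    ∃ t, 0 ≤ t ∧ t < 2 * π ∧ v = dir (φ + σ * t) := by
  have h1 : v 0 ^ 2 + v 1 ^ 2 = 1 := by rw [← Pt.norm_sq, hv]; norm_num
  obtain ⟨θ, hθ⟩ : ∃ θ, v = dir θ := by
    have hz : ‖(⟨v 0, v 1⟩ : ℂ)‖ = 1 := by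
      rw [Complex.norm_def, Complex.normSq_mk, ← sq, ← sq, h1, Real.sqrt_one]
    refine ⟨Complex.arg ⟨v 0, v 1⟩, Pt.ext' ?_ ?_⟩
    · have := Complex.norm_mul_cos_arg ⟨v 0, v 1⟩
      rw [hz] at this; simpa using this.symm
    · have := Complex.norm_mul_sin_arg ⟨v 0, v 1⟩
      rw [hz] at this; simpa using this.symm
  have hm := toIcoMod_mem_Ico Real.two_pi_pos 0 (σ * (θ - φ))
  refine ⟨toIcoMod Real.two_pi_pos 0 (σ * (θ - φ)), hm.1, by simpa using hm.2, ?_⟩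
  rw [hθ, dir_eq_iff]
  have h2 := toIcoMod_add_toIcoDiv_zsmul Real.two_pi_pos 0 (σ * (θ - φ))
  rw [zsmul_eq_mul] at h2
  rcases hσ with rfl | rfl
  · exact ⟨toIcoDiv Real.two_pi_pos 0 (1 * (θ - φ)), by linarith⟩
  · exact ⟨-toIcoDiv Real.two_pi_pos 0 (-1 * (θ - φ)), by push_cast; linarith⟩

lemma norm_dir_sub_sq (x y : ℝ) : ‖dir x - dir y‖ ^ 2 = 2 - 2 * Real.cos (x - y) := by
  rw [norm_sub_sq_real, inner_dir]; simp; ring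

lemma dist_add_dir (O : Pt) (x : ℝ) : dist O (O + dir x) = 1 := by simp

lemma dist_add_dir_eq_one {O : Pt} {x y : ℝ} :
    dist (O + dir x) (O + dir y) = 1 ↔ Real.cos (x - y) = 1 / 2 := by
  rw [dist_add_left, dist_eq_norm, ← sq_eq_sq₀ (norm_nonneg _) zero_le_one, norm_dir_sub_sq]
  constructor <;> intro h <;> linarith

lemma cos_mul_sign {σ : ℝ} (hσ : σ = 1 ∨ σ = -1) (x : ℝ) : Real.cos (σ * x) = Real.cos x := by
  rcases hσ with rfl | rfl <;> simp

lemma mem_Icc_of_cos_le_half {x : ℝ} (h0 : 0 < x) (h1 : x < 2 * π) (h : Real.cos x ≤ 1 / 2) :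
    π / 3 ≤ x ∧ x ≤ 5 * π / 3 := by
  have hpi := Real.pi_pos
  constructor <;> by_contra! hx
  · have := Real.cos_lt_cos_of_nonneg_of_le_pi h0.le (by linarith) hx
    rw [Real.cos_pi_div_three] at this; linarith
  · have := Real.cos_lt_cos_of_nonneg_of_le_pi (x := 2 * π - x) (y := π / 3)
      (by linarith) (by linarith) (by linarith)
    rw [Real.cos_pi_div_three, Real.cos_two_pi_sub] at this; linarith

lemma eq_of_cos_eq_half {x : ℝ} (h0 : 0 < x) (h1 : x < 2 * π) (h : Real.cos x = 1 / 2) :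
    x = π / 3 ∨ x = 5 * π / 3 := by
  have hpi := Real.pi_pos
  rcases le_total x π with hx | hx
  · left
    exact Real.injOn_cos ⟨h0.le, hx⟩ ⟨by linarith, by linarith⟩
      (by rw [h, Real.cos_pi_div_three])
  · right
    have := Real.injOn_cos (x₁ := 2 * π - x) (x₂ := π / 3) ⟨by linarith, by linarith⟩
      ⟨by linarith, by linarith⟩ (by rw [Real.cos_two_pi_sub, h, Real.cos_pi_div_three])
    linarith

lemma PennyGP.cos_sub_le {P : Finset Pt} (hP : PennyGP P) {O : Pt} {x y : ℝ}
    (hx : O + dir x ∈ P) (hy : O + dir y ∈ P) (hne : dir x ≠ dir y) :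
    Real.cos (x - y) ≤ 1 / 2 := by
  have h := hP.1 _ hx _ hy (by simpa using hne)
  rw [dist_add_left, dist_eq_norm] at h
  have := norm_dir_sub_sq x y
  nlinarith

lemma PennyGP.not_collinear_dir {P : Finset Pt} (hP : PennyGP P) {O : Pt} {ζ a b : ℝ}
    (hO : O ∈ P) (ha : O + a • dir ζ ∈ P) (hb : O + b • dir ζ ∈ P)
    (ha0 : a ≠ 0) (hb0 : b ≠ 0) (hab : a ≠ b) : False := by
  have hd : dir ζ ≠ 0 := by
    intro h; have := norm_dir ζ; rw [h] at this; simp at this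
  refine hP.2 _ hO _ ha _ hb ?_ ?_ ?_ ?_
  · simpa using ⟨ha0, hd⟩
  · simpa using ⟨hb0, hd⟩
  · simpa [hd] using hab
  · rw [collinear_iff_of_mem (p₀ := O) (by simp)]
    refine ⟨dir ζ, ?_⟩
    intro p hp
    simp only [Set.mem_insert_iff, Set.mem_singleton_iff] at hp
    rcases hp with rfl | rfl | rfl
    · exact ⟨0, by simp⟩
    · exact ⟨a, by simp [add_comm]⟩
    · exact ⟨b, by simp [add_comm]⟩

lemma PennyGP.not_antipodal {P : Finset Pt} (hP : PennyGP P) {O : Pt} {x y : ℝ}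
    (hO : O ∈ P) (hx : O + dir x ∈ P) (hy : O + dir y ∈ P) : y ≠ x + π := by
  rintro rfl
  rw [dir_add_pi] at hy
  exact hP.not_collinear_dir (ζ := x) (a := 1) (b := -1) hO (by simpa using hx)
    (by simpa using hy) (by norm_num) (by norm_num) (by norm_num)

/-- The unit-neighbors of a point, listed by increasing angle from the reference direction `φ`
in the rotational direction `σ`. -/
lemma PennyGP.exists_angles {P : Finset Pt} (hP : PennyGP P) (Y : Pt) (φ : ℝ) {σ : ℝ}
    (hσ : σ = 1 ∨ σ = -1) {n : ℕ} (hn : deg P Y = n) :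
    ∃ t : Fin n → ℝ, (∀ i, 0 ≤ t i) ∧ (∀ i, t i < 2 * π) ∧
      (∀ i, Y + dir (φ + σ * t i) ∈ P) ∧
      (∀ i j, i < j → π / 3 ≤ t j - t i ∧ t j - t i ≤ 5 * π / 3) ∧
      ∀ q ∈ P, dist Y q = 1 → ∃ i, q = Y + dir (φ + σ * t i) := by
  classical
  set N : Finset Pt := P.filter fun q => dist Y q = 1 with hN
  have hcard : N.card = n := by
    rw [← hn, deg, ← Set.ncard_coe_finset]
    congr 1; ext q; simp [hN]
  have hex : ∀ q : Pt, ∃ t : ℝ, dist Y q = 1 →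
      0 ≤ t ∧ t < 2 * π ∧ q = Y + dir (φ + σ * t) := by
    intro q
    by_cases h : dist Y q = 1
    · obtain ⟨t, h1, h2, h3⟩ := exists_dir (v := q - Y) (by rwa [← dist_eq_norm, dist_comm])
        (φ := φ) hσ
      exact ⟨t, fun _ => ⟨h1, h2, by rw [← h3]; abel⟩⟩
    · exact ⟨0, fun h' => absurd h' h⟩
  choose f hf using hex
  have hNf : ∀ q ∈ N, q ∈ P ∧ 0 ≤ f q ∧ f q < 2 * π ∧ q = Y + dir (φ + σ * f q) := by
    intro q hq
    rw [hN, Finset.mem_filter] at hq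
    exact ⟨hq.1, hf q hq.2⟩
  have hTcard : (N.image f).card = n := by
    rw [Finset.card_image_of_injOn, hcard]
    intro p hp q hq hpq
    rw [(hNf p hp).2.2.2, (hNf q hq).2.2.2, hpq]
  have hT : ∀ s ∈ N.image f, 0 ≤ s ∧ s < 2 * π ∧ Y + dir (φ + σ * s) ∈ P := by
    intro s hs
    obtain ⟨q, hq, rfl⟩ := Finset.mem_image.1 hs
    obtain ⟨h1, h2, h3, h4⟩ := hNf q hq
    exact ⟨h2, h3, h4 ▸ h1⟩
  set t := (N.image f).orderEmbOfFin hTcard with ht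
  have htm : ∀ i, t i ∈ N.image f := fun i => Finset.orderEmbOfFin_mem _ _ i
  refine ⟨t, fun i => (hT _ (htm i)).1, fun i => (hT _ (htm i)).2.1,
    fun i => (hT _ (htm i)).2.2, ?_, ?_⟩
  · intro i j hij
    have hlt : t i < t j := t.strictMono hij
    obtain ⟨hi0, hi1, hi2⟩ := hT _ (htm i)
    obtain ⟨hj0, hj1, hj2⟩ := hT _ (htm j)
    apply mem_Icc_of_cos_le_half (by linarith) (by linarith)
    have := hP.cos_sub_le hj2 hi2 (fun h => hlt.ne'
      (eq_of_dir_eq hσ h (by linarith) (by linarith)))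
    rwa [show φ + σ * t j - (φ + σ * t i) = σ * (t j - t i) by ring, cos_mul_sign hσ] at this
  · intro q hq hYq
    have hqN : q ∈ N := by rw [hN, Finset.mem_filter]; exact ⟨hq, hYq⟩
    have hr : f q ∈ Set.range t := by
      rw [ht, Finset.range_orderEmbOfFin]
      exact_mod_cast Finset.mem_image_of_mem f hqN
    obtain ⟨i, hi⟩ := hr
    exact ⟨i, by rw [hi]; exact (hNf q hqN).2.2.2⟩

lemma PennyGP.deg_le_five {P : Finset Pt} (hP : PennyGP P) {Y : Pt} (hY : Y ∈ P) :
    deg P Y ≤ 5 := by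
  by_contra! h
  obtain ⟨t, h0, h1, hm, hg, -⟩ := hP.exists_angles Y 0 (Or.inl rfl) (n := deg P Y) rfl
  have g := fun (i : ℕ) (hi : i < 5) => (hg ⟨i, by omega⟩ ⟨i + 1, by omega⟩ (by simp)).1
  have g0 := g 0 (by norm_num)
  have g1 := g 1 (by norm_num)
  have g2 := g 2 (by norm_num)
  have g3 := g 3 (by norm_num)
  have g4 := g 4 (by norm_num)
  have g5 := (hg ⟨0, by omega⟩ ⟨5, by omega⟩ (by simp)).2
  norm_num at g0 g1 g2 g3 g4
  exact hP.not_antipodal hY (hm ⟨0, by omega⟩) (hm ⟨3, by omega⟩) (by linarith)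

/-- The neighbors of a point of degree 5 two of whose neighbors are 60 degrees apart. -/
lemma PennyGP.exists_three_angles {P : Finset Pt} (hP : PennyGP P) {Y : Pt} {φ σ : ℝ}
    (hσ : σ = 1 ∨ σ = -1) (hd : deg P Y = 5)
    (h0 : Y + dir φ ∈ P) (h1 : Y + dir (φ + σ * (π / 3)) ∈ P) :
    ∃ a b c : ℝ, 2 * π / 3 ≤ a ∧ a + π / 3 ≤ b ∧ b + π / 3 ≤ c ∧ c ≤ 5 * π / 3 ∧
      Y + dir (φ + σ * a) ∈ P ∧ Y + dir (φ + σ * b) ∈ P ∧ Y + dir (φ + σ * c) ∈ P ∧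
      ∀ q ∈ P, dist Y q = 1 → q = Y + dir φ ∨ q = Y + dir (φ + σ * (π / 3)) ∨
        q = Y + dir (φ + σ * a) ∨ q = Y + dir (φ + σ * b) ∨ q = Y + dir (φ + σ * c) := by
  have hpi := Real.pi_pos
  obtain ⟨t, ht0, ht1, hm, hg, hs⟩ := hP.exists_angles Y φ hσ hd
  have g01 := hg 0 1 (by decide)
  have g12 := hg 1 2 (by decide)
  have g23 := hg 2 3 (by decide)
  have g34 := hg 3 4 (by decide)
  have g04 := hg 0 4 (by decide)
  have p0 := ht0 0
  have e0 : t 0 = 0 := by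
    obtain ⟨i, hi⟩ := hs _ h0 (dist_add_dir _ _)
    have hi' : dir (φ + σ * t i) = dir (φ + σ * 0) := by
      simpa using hi.symm
    have := eq_of_dir_eq hσ hi' (by linarith [ht1 i]) (by linarith [ht0 i])
    by_cases h : i = 0
    · rwa [h] at this
    · have := hg 0 i (Fin.pos_of_ne_zero h)
      linarith
  have e1 : t 1 = π / 3 := by
    obtain ⟨i, hi⟩ := hs _ h1 (dist_add_dir _ _)
    have hi' : dir (φ + σ * t i) = dir (φ + σ * (π / 3)) := by
      simpa using hi.symm
    have := eq_of_dir_eq hσ hi' (by linarith [ht1 i]) (by linarith [ht0 i])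
    fin_cases i <;> simp at this <;> linarith
  refine ⟨t 2, t 3, t 4, by linarith, by linarith, by linarith, by linarith,
    hm 2, hm 3, hm 4, fun q hq hYq => ?_⟩
  obtain ⟨i, hi⟩ := hs q hq hYq
  fin_cases i
  · left; simpa [e0] using hi
  · right; left; simpa [e1] using hi
  · right; right; left; simpa using hi
  · right; right; right; left; simpa using hi
  · right; right; right; right; simpa using hi

/-- In a path of three unit edges whose inner angles lie on the same side, the two inner angles
`π - s` and `y` have sum at least `π`. -/
lemma PennyGP.le_of_path {P : Finset Pt} (hP : PennyGP P) {O : Pt} {χ τ s y : ℝ}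
    (hτ : τ = 1 ∨ τ = -1) (hsπ : s < π) (hy : π / 3 < y) (hyπ : y < π)
    (hS : O + dir (χ + τ * y) ∈ P) (hT : O + dir χ + dir (χ + τ * s) ∈ P) : s ≤ y := by
  have hpi := Real.pi_pos
  by_contra! hlt
  have hcy : Real.cos y < 1 / 2 := by
    rw [← Real.cos_pi_div_three]
    exact Real.cos_lt_cos_of_nonneg_of_le_pi (by linarith) hyπ.le hy
  have hne : O + dir χ + dir (χ + τ * s) ≠ O + dir (χ + τ * y) := by
    intro h
    have h1 : dir (χ + τ * y) - dir χ = dir (χ + τ * s) := by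
      rw [sub_eq_iff_eq_add, add_comm (dir _), ← add_right_inj O, ← h, add_assoc]
    have h2 := norm_dir_sub_sq (χ + τ * y) χ
    rw [h1, norm_dir, add_sub_cancel_left, cos_mul_sign hτ] at h2
    linarith
  have h1 := hP.1 _ hT _ hS hne
  rw [add_assoc, dist_add_left, dist_eq_norm] at h1
  have h2 : ‖dir χ + dir (χ + τ * s) - dir (χ + τ * y)‖ ^ 2 =
      3 + 2 * Real.cos s - 2 * Real.cos y - 2 * Real.cos (s - y) := by
    rw [norm_sub_sq_real, norm_add_sq_real, inner_add_left, inner_dir, inner_dir, inner_dir,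
      ← cos_mul_sign hτ s, ← cos_mul_sign hτ y, ← cos_mul_sign hτ (s - y)]
    rw [show χ - (χ + τ * s) = -(τ * s) by ring, show χ - (χ + τ * y) = -(τ * y) by ring,
      show χ + τ * s - (χ + τ * y) = τ * (s - y) by ring, Real.cos_neg, Real.cos_neg]
    simp; ring
  have h3 : 1 + Real.cos s - Real.cos y - Real.cos (s - y) =
      -4 * Real.sin ((s - y) / 2) * Real.sin (y / 2) * Real.cos (s / 2) := by
    have e1 := Real.cos_sub_cos s y
    have e2 := Real.sin_sub_sin ((s + y) / 2) ((s - y) / 2)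
    rw [show ((s + y) / 2 - (s - y) / 2) / 2 = y / 2 by ring,
      show ((s + y) / 2 + (s - y) / 2) / 2 = s / 2 by ring] at e2
    have e3 : Real.cos (s - y) = 1 - 2 * Real.sin ((s - y) / 2) ^ 2 := by
      rw [show s - y = 2 * ((s - y) / 2) by ring, Real.cos_two_mul,
        show 2 * ((s - y) / 2) / 2 = (s - y) / 2 by ring, Real.cos_sq']; ring
    linear_combination e1 - e3 - 2 * Real.sin ((s - y) / 2) * e2
  have p1 : 0 < Real.sin ((s - y) / 2) := Real.sin_pos_of_pos_of_lt_pi (by linarith) (by linarith)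
  have p2 : 0 < Real.sin (y / 2) := Real.sin_pos_of_pos_of_lt_pi (by linarith) (by linarith)
  have p3 : 0 < Real.cos (s / 2) := Real.cos_pos_of_mem_Ioo ⟨by linarith, by linarith⟩
  have p4 := mul_pos (mul_pos p1 p2) p3
  nlinarith

/-- A path of four unit edges with inner angles `π - e`, `β`, `π - e'` of sum at most `5 * π / 3`
closes up to a rhombus. -/
lemma PennyGP.eq_of_pentagon {P : Finset Pt} (hP : PennyGP P) {A : Pt} {φ β e e' : ℝ}
    (hβ : β < π) (he : e ≤ β) (he' : e' ≤ β) (he2 : e < 2 * π / 3) (he2' : e' < 2 * π / 3)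
    (hsum : β + π / 3 ≤ e + e')
    (h1 : A + dir φ + dir (φ + e) ∈ P) (h2 : A + dir (φ + β) + dir (φ + β - e') ∈ P) :
    e = β ∧ e' = β := by
  have hpi := Real.pi_pos
  set a := (β - e) / 2 with ha
  set b := (β - e') / 2 with hb
  have ea : e = β - 2 * a := by rw [ha]; ring
  have eb : e' = β - 2 * b := by rw [hb]; ring
  have ha0 : 0 ≤ a := by linarith
  have hb0 : 0 ≤ b := by linarith
  have hD : ‖(A + dir φ + dir (φ + e)) - (A + dir (φ + β) + dir (φ + β - e'))‖ ^ 2 =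
      4 * (Real.sin a ^ 2 + Real.sin b ^ 2 +
        2 * Real.sin a * Real.sin b * Real.cos (β - a - b)) := by
    have e1 : (A + dir φ + dir (φ + e)) - (A + dir (φ + β) + dir (φ + β - e')) =
        (dir φ - dir (φ + 2 * b)) + (dir (φ + β - 2 * a) - dir (φ + β)) := by
      rw [ea, eb, show φ + β - (β - 2 * b) = φ + 2 * b by ring,
        show φ + (β - 2 * a) = φ + β - 2 * a by ring]
      abel
    rw [e1, dir_sub_dir, dir_sub_dir, norm_add_sq_real, norm_smul, norm_smul, inner_smul_left,
      inner_smul_right, inner_dir, norm_dir, norm_dir,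
      show (φ + 2 * b - φ) / 2 = b by ring, show (φ + β - (φ + β - 2 * a)) / 2 = a by ring,
      show (φ + (φ + 2 * b)) / 2 - π / 2 - ((φ + β - 2 * a + (φ + β)) / 2 - π / 2) =
        -(β - a - b) by ring, Real.cos_neg, mul_one, mul_one, Real.norm_eq_abs, Real.norm_eq_abs,
      sq_abs, sq_abs]
    simp; ring
  have hsa : 0 ≤ Real.sin a := Real.sin_nonneg_of_nonneg_of_le_pi ha0 (by linarith)
  have hsb : 0 ≤ Real.sin b := Real.sin_nonneg_of_nonneg_of_le_pi hb0 (by linarith)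
  have hcos : Real.cos (β - a - b) ≤ Real.cos (π / 3 + a + b) :=
    Real.cos_le_cos_of_nonneg_of_le_pi (by linarith) (by linarith) (by linarith)
  have hid : 1 - 4 * (Real.sin a ^ 2 + Real.sin b ^ 2 +
      2 * Real.sin a * Real.sin b * Real.cos (π / 3 + a + b)) =
      4 * Real.cos (π / 3 - a - b) * (Real.cos (a - b) - Real.cos (π / 3 - a - b)) := by
    have h3 : Real.sqrt 3 ^ 2 = 3 := Real.sq_sqrt (by norm_num)
    have q1 := Real.sin_sq_add_cos_sq a
    have q2 := Real.sin_sq_add_cos_sq b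
    have f1 := Real.sin_sq_add_cos_sq (a + b)
    have f2 : Real.sin (a + b) ^ 2 = Real.sin a ^ 2 + Real.sin b ^ 2 +
        2 * Real.sin a * Real.sin b * Real.cos (a + b) := by
      rw [Real.sin_add, Real.cos_add]
      linear_combination (Real.sin b ^ 2) * q1 + (Real.sin a ^ 2) * q2
    have f3 : Real.cos (a - b) = Real.cos (a + b) + 2 * Real.sin a * Real.sin b := by
      rw [Real.cos_add, Real.cos_sub]; ring
    rw [f3, add_assoc (π / 3), sub_sub (π / 3), Real.cos_add (π / 3), Real.cos_sub (π / 3),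
      Real.cos_pi_div_three, Real.sin_pi_div_three]
    linear_combination -f1 + 4 * f2 + Real.sin (a + b) ^ 2 * h3
  have hlt : Real.cos (π / 3 - a - b) < Real.cos (a - b) := by
    rw [← Real.cos_abs (a - b)]
    apply Real.cos_lt_cos_of_nonneg_of_le_pi (abs_nonneg _) (by linarith)
    rw [abs_lt]; constructor <;> linarith
  have hpos : 0 < Real.cos (π / 3 - a - b) :=
    Real.cos_pos_of_mem_Ioo ⟨by linarith, by linarith⟩
  have hlt1 : ‖(A + dir φ + dir (φ + e)) - (A + dir (φ + β) + dir (φ + β - e'))‖ ^ 2 < 1 := by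
    rw [hD]
    have := mul_pos hpos (sub_pos.2 hlt)
    have := mul_le_mul_of_nonneg_left hcos (mul_nonneg hsa hsb)
    nlinarith
  have heq : A + dir φ + dir (φ + e) = A + dir (φ + β) + dir (φ + β - e') := by
    by_contra hne
    have := hP.1 _ h1 _ h2 hne
    rw [dist_eq_norm] at this
    nlinarith
  rw [heq, sub_self, norm_zero] at hD
  have hc1 : -1 < Real.cos (β - a - b) := by
    rw [← Real.cos_pi]
    apply Real.cos_lt_cos_of_nonneg_of_le_pi (by linarith) le_rfl (by linarith)
  have hzero : Real.sin a = 0 ∧ Real.sin b = 0 := by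
    have hm := mul_nonneg hsa hsb
    rcases hm.lt_or_eq with hm | hm
    · nlinarith [sq_nonneg (Real.sin a - Real.sin b),
        mul_pos hm (show 0 < 1 + Real.cos (β - a - b) by linarith)]
    · constructor <;> nlinarith [sq_nonneg (Real.sin a), sq_nonneg (Real.sin b)]
  have hza : a = 0 := by
    rcases ha0.lt_or_eq with h | h
    · exact absurd hzero.1 (Real.sin_pos_of_pos_of_lt_pi h (by linarith)).ne'
    · exact h.symm
  have hzb : b = 0 := by
    rcases hb0.lt_or_eq with h | h
    · exact absurd hzero.2 (Real.sin_pos_of_pos_of_lt_pi h (by linarith)).ne'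
    · exact h.symm
  constructor <;> linarith

lemma dir_third_sub {σ : ℝ} (hσ : σ = 1 ∨ σ = -1) (x : ℝ) :
    dir (x + σ * (π / 3)) - dir x = dir (x + π - σ * (π / 3)) := by
  rw [show x + π - σ * (π / 3) = x - σ * (π / 3) + π by ring, dir_add_pi,
    ← dir_add_dir_third x]
  rcases hσ with rfl | rfl
  · simp
  · simp [sub_eq_add_neg]

/-- `B` has degree 5, is popular, and the edge `AB` is of Type II. -/
def IsTypeII (P : Finset Pt) (A B : Pt) : Prop :=
  deg P B = 5 ∧ ¬ Unpopular P B ∧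
    ∃ C₁ ∈ P, ∃ C₂ ∈ P, ∃ C₃ ∈ P, ∃ C₄ ∈ P,
      List.Pairwise (· ≠ ·) [C₁, C₂, C₃, C₄, A] ∧
      dist B C₁ = 1 ∧ dist B C₂ = 1 ∧ dist B C₃ = 1 ∧ dist B C₄ = 1 ∧
      (AngOrder B [C₁, C₂, C₃, C₄, A] ∨ AngOrder B [A, C₄, C₃, C₂, C₁]) ∧
      dist C₁ C₂ = 1 ∧ dist C₃ C₄ = 1 ∧ dist C₄ A = 1

/-- The neighbors of `B = A + dir φ` other than `A` and `A + dir (φ + σ * (π / 3))`, where `AB` is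
an edge of Type II and `e` is the angle between its second and third neighbors. -/
structure TypeIIAngle (P : Finset Pt) (A : Pt) (φ σ e : ℝ) : Prop where
  lt : π / 3 < e
  gt : e < 2 * π / 3
  mem₁ : A + dir φ + dir (φ - σ * e) ∈ P
  deg₁ : deg P (A + dir φ + dir (φ - σ * e)) = 5
  mem₂ : A + dir φ + dir (φ - σ * e + σ * (π / 3)) ∈ P
  deg₂ : deg P (A + dir φ + dir (φ - σ * e + σ * (π / 3))) = 5
  mem₃ : A + dir φ + dir (φ + σ * (π / 3)) ∈ P
  deg₃ : deg P (A + dir φ + dir (φ + σ * (π / 3))) = 5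

lemma AngOrder.get_eq {X : Pt} {ws : List Pt} (h : AngOrder X ws) (hd : ∀ w ∈ ws, dist X w = 1) :
    ∃ θ : Fin ws.length → ℝ, StrictMono θ ∧ (∀ i j, θ j - θ i < 2 * π) ∧
      ∀ i, ws.get i = X + dir (θ i) := by
  obtain ⟨θ, r, hr, hm, hl, hp⟩ := h
  refine ⟨θ, hm, hl, fun i => ?_⟩
  have h1 := hd _ (List.get_mem ws i)
  have h2 : ws.get i = X + r i • dir (θ i) := hp i
  rw [h2] at h1 ⊢
  have h3 : r i = 1 := by
    simpa [norm_smul, abs_of_pos (hr i)] using h1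
  rw [h3, one_smul]

lemma exists_angles_of_angOrder {B C₁ C₂ C₃ C₄ A : Pt}
    (h : AngOrder B [C₁, C₂, C₃, C₄, A] ∨ AngOrder B [A, C₄, C₃, C₂, C₁])
    (h1 : dist B C₁ = 1) (h2 : dist B C₂ = 1) (h3 : dist B C₃ = 1) (h4 : dist B C₄ = 1)
    (h5 : dist B A = 1) :
    ∃ τ : ℝ, (τ = 1 ∨ τ = -1) ∧ ∃ x₁ x₂ x₃ x₄ x₅ : ℝ,
      x₁ < x₂ ∧ x₂ < x₃ ∧ x₃ < x₄ ∧ x₄ < x₅ ∧ x₅ < x₁ + 2 * π ∧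
      C₁ = B + dir (τ * x₁) ∧ C₂ = B + dir (τ * x₂) ∧ C₃ = B + dir (τ * x₃) ∧
      C₄ = B + dir (τ * x₄) ∧ A = B + dir (τ * x₅) := by
  rcases h with h | h <;>
  · obtain ⟨θ, hm, hl, hp⟩ := h.get_eq (by simp [h1, h2, h3, h4, h5])
    have m1 : θ ⟨0, by simp⟩ < θ ⟨1, by simp⟩ := hm (by simp)
    have m2 : θ ⟨1, by simp⟩ < θ ⟨2, by simp⟩ := hm (by simp)
    have m3 : θ ⟨2, by simp⟩ < θ ⟨3, by simp⟩ := hm (by simp)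
    have m4 : θ ⟨3, by simp⟩ < θ ⟨4, by simp⟩ := hm (by simp)
    have m5 := hl ⟨0, by simp⟩ ⟨4, by simp⟩
    have p0 := hp ⟨0, by simp⟩
    have p1 := hp ⟨1, by simp⟩
    have p2 := hp ⟨2, by simp⟩
    have p3 := hp ⟨3, by simp⟩
    have p4 := hp ⟨4, by simp⟩
    first
    | exact ⟨1, Or.inl rfl, _, _, _, _, _, m1, m2, m3, m4, by linarith,
        by simpa using p0, by simpa using p1, by simpa using p2, by simpa using p3,
        by simpa using p4⟩
    | exact ⟨-1, Or.inr rfl, _, _, _, _, _, neg_lt_neg m4, neg_lt_neg m3, neg_lt_neg m2,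
        neg_lt_neg m1, by linarith, by simpa using p4, by simpa using p3, by simpa using p2,
        by simpa using p1, by simpa using p0⟩

lemma PennyGP.deg_eq_five {P : Finset Pt} (hP : PennyGP P) {A B C : Pt} (hA : A ∈ P)
    (hdA : deg P A = 4) (hB5 : deg P B = 5) (hpop : ¬ Unpopular P B) (hBA : dist B A = 1)
    (hC : C ∈ P) (hBC : dist B C = 1) (hCA : C ≠ A) : deg P C = 5 := by
  have h1 := hP.deg_le_five hC
  by_contra h2
  apply hpop
  by_cases h3 : deg P C ≤ 3
  · exact Or.inr (Or.inl ⟨hB5, C, hC, hBC, h3⟩)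
  · exact Or.inr (Or.inr ⟨hB5, C, hC, A, hA, hCA, hBC, hBA, by omega, hdA⟩)

lemma PennyGP.exists_typeIIAngle {P : Finset Pt} (hP : PennyGP P) {A : Pt} (hA : A ∈ P)
    (hdA : deg P A = 4) (hap : ¬ InApricot P A) {φ σ : ℝ} (hσ : σ = 1 ∨ σ = -1)
    (hBP : A + dir φ ∈ P)
    (huniq : ∀ q ∈ P, dist A q = 1 → dist (A + dir φ) q = 1 → q = A + dir (φ + σ * (π / 3)))
    (hB : IsTypeII P A (A + dir φ)) : ∃ e, TypeIIAngle P A φ σ e := by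
  have hpi := Real.pi_pos
  obtain ⟨hB5, hpop, C₁, hC₁, C₂, hC₂, C₃, hC₃, C₄, hC₄, hpw, d1, d2, d3, d4, hord, d12, d34, d4A⟩ :=
    hB
  set B := A + dir φ with hBdef
  have dBA : dist B A = 1 := by simp [hBdef]
  simp only [List.pairwise_cons, List.mem_cons, List.not_mem_nil, or_false, forall_eq_or_imp,
    forall_eq, ne_eq] at hpw
  obtain ⟨⟨n12, n13, n14, n1A⟩, ⟨n23, n24, n2A⟩, ⟨n34, n3A⟩, n4A, -⟩ := hpw
  have D1 := hP.deg_eq_five hA hdA hB5 hpop dBA hC₁ d1 n1A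
  have D2 := hP.deg_eq_five hA hdA hB5 hpop dBA hC₂ d2 n2A
  have D3 := hP.deg_eq_five hA hdA hB5 hpop dBA hC₃ d3 n3A
  have D4 := hP.deg_eq_five hA hdA hB5 hpop dBA hC₄ d4 n4A
  have hC4 := huniq C₄ hC₄ (by rwa [dist_comm]) d4
  obtain ⟨τ, hτ, x₁, x₂, x₃, x₄, x₅, l1, l2, l3, l4, l5, r1, r2, r3, r4, r5⟩ :=
    exists_angles_of_angOrder hord d1 d2 d3 d4 dBA
  have half {x y : ℝ} {p q : Pt} (hp : p = B + dir (τ * x)) (hq : q = B + dir (τ * y)) :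
      dist p q = 1 ↔ Real.cos (y - x) = 1 / 2 := by
    rw [hp, hq, dist_add_dir_eq_one, ← mul_sub, cos_mul_sign hτ, ← Real.cos_neg, neg_sub]
  have gap {x y : ℝ} {p q : Pt} (hp : p = B + dir (τ * x)) (hq : q = B + dir (τ * y))
      (hpP : p ∈ P) (hqP : q ∈ P) (hne : p ≠ q) (h0 : x < y) (h1 : y < x + 2 * π) :
      π / 3 ≤ y - x ∧ y - x ≤ 5 * π / 3 := by
    apply mem_Icc_of_cos_le_half (by linarith) (by linarith)
    rw [hp] at hpP hne
    rw [hq] at hqP hne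
    have := hP.cos_sub_le hqP hpP (fun h => hne (by rw [h]))
    rwa [← mul_sub, cos_mul_sign hτ] at this
  have g1 := gap r1 r2 hC₁ hC₂ n12 l1 (by linarith)
  have g2 := gap r2 r3 hC₂ hC₃ n23 l2 (by linarith)
  have g3 := gap r3 r4 hC₃ hC₄ n34 l3 (by linarith)
  have g4 := gap r4 r5 hC₄ hA n4A l4 (by linarith)
  have g5 := gap r1 r5 hC₁ hA n1A (by linarith) (by linarith)
  have s1 : x₂ - x₁ = π / 3 := by
    rcases eq_of_cos_eq_half (by linarith) (by linarith) ((half r1 r2).1 d12) with h | h <;>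
      linarith
  have s3 : x₄ - x₃ = π / 3 := by
    rcases eq_of_cos_eq_half (by linarith) (by linarith) ((half r3 r4).1 d34) with h | h <;>
      linarith
  have s4 : x₅ - x₄ = π / 3 := by
    rcases eq_of_cos_eq_half (by linarith) (by linarith) ((half r4 r5).1 d4A) with h | h <;>
      linarith
  have hx5 : dir (τ * x₅) = dir (φ + π) := by
    have h : A = A + (dir φ + dir (τ * x₅)) := by rw [← add_assoc]; exact r5
    rw [dir_add_pi, eq_neg_iff_add_eq_zero, add_comm]
    simpa using h
  have hτσ : τ = σ := by
    have h1 : dir (τ * x₄) = dir (φ + π - σ * (π / 3)) := by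
      rw [← dir_third_sub hσ, eq_sub_iff_add_eq', ← add_right_inj A, ← add_assoc, ← hBdef, ← r4,
        hC4]
    have h2 : dir (τ * x₄) = dir (φ + π + -(τ * (π / 3))) := by
      rw [← dir_add_congr hx5]; congr 1; rw [← s4]; ring
    have h3 : dir (φ + π + σ * -(π / 3)) = dir (φ + π + σ * (-(τ * σ) * (π / 3))) := by
      rw [show φ + π + σ * -(π / 3) = φ + π - σ * (π / 3) by ring, ← h1, h2]
      congr 1
      rcases hσ with rfl | rfl <;> ring
    rcases hσ with rfl | rfl <;> rcases hτ with rfl | rfl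
    · rfl
    · have := eq_of_dir_eq (Or.inl rfl) h3 (by linarith) (by linarith)
      linarith
    · have := eq_of_dir_eq (Or.inr rfl) h3 (by linarith) (by linarith)
      linarith
    · rfl
  subst hτσ
  have key (w : ℝ) : dir (τ * (x₅ - w)) = dir (φ + τ * (π - w)) := by
    rw [mul_sub, sub_eq_add_neg, dir_add_congr hx5]
    rcases hτ with rfl | rfl
    · congr 1; ring
    · rw [← dir_add_two_pi (φ + -1 * (π - w))]; congr 1; ring
  obtain ⟨e, he⟩ : ∃ e, e = x₃ - x₂ := ⟨_, rfl⟩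
  rw [← he] at g2
  have f1 : C₁ = B + dir (φ - τ * e) := by
    rw [r1, show x₁ = x₅ - (π + e) by linarith, key]; congr 2; ring
  have f2 : C₂ = B + dir (φ - τ * e + τ * (π / 3)) := by
    rw [r2, show x₂ = x₅ - (2 * π / 3 + e) by linarith, key]; congr 2; ring
  have f3 : C₃ = B + dir (φ + τ * (π / 3)) := by
    rw [r3, show x₃ = x₅ - (2 * π / 3) by linarith, key]; congr 2; ring
  refine ⟨e, lt_of_le_of_ne g2.1 ?_, lt_of_le_of_ne (by linarith) ?_,
    f1 ▸ hC₁, f1 ▸ D1, f2 ▸ hC₂, f2 ▸ D2, f3 ▸ hC₃, f3 ▸ D3⟩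
  · intro h
    have d23 : dist C₂ C₃ = 1 := by rw [half r2 r3, ← he, ← h, Real.cos_pi_div_three]
    have nB {C : Pt} (h : dist B C = 1) : B ≠ C := by rintro rfl; simp at h
    refine hap ⟨B, C₄, C₃, C₂, ⟨hBP, hC₄, hC₃, hC₂, ?_, hB5, D4, D3, D2, d4, by rwa [dist_comm],
      by rwa [dist_comm], by rwa [dist_comm], d3⟩, ?_, Or.inl (by rwa [dist_comm])⟩
    · simp [nB d2, nB d3, nB d4, Ne.symm n34, Ne.symm n24, Ne.symm n23]
    · simp [(nB dBA).symm, Ne.symm n4A, Ne.symm n3A, Ne.symm n2A]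
  · intro h
    have d1A : dist C₁ A = 1 := by
      rw [half r1 r5, show x₅ - x₁ = 2 * π - π / 3 by linarith, Real.cos_two_pi_sub,
        Real.cos_pi_div_three]
    exact n14 ((huniq C₁ hC₁ (by rwa [dist_comm]) d1).trans hC4.symm)

lemma dir_sub_sign_mul_pi {σ : ℝ} (hσ : σ = 1 ∨ σ = -1) (x : ℝ) :
    dir (x - σ * π) = dir (x + π) := by
  rcases hσ with rfl | rfl
  · rw [← dir_add_two_pi]; congr 1; ring
  · congr 1; ring

lemma dir_add_dir_two_thirds {σ : ℝ} (hσ : σ = 1 ∨ σ = -1) (x : ℝ) :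
    dir x + dir (x + σ * (2 * π / 3)) = dir (x + σ * (π / 3)) := by
  rw [← dir_add_dir_third (x + σ * (π / 3))]
  rcases hσ with rfl | rfl
  · rw [add_comm]; congr 2 <;> ring
  · congr 2 <;> ring

lemma TypeIIAngle.congr {P : Finset Pt} {A : Pt} {φ φ' σ e : ℝ} (h : TypeIIAngle P A φ σ e)
    (hφ : dir φ = dir φ') : TypeIIAngle P A φ' σ e := by
  obtain ⟨h1, h2, h3, h4, h5, h6, h7, h8⟩ := h
  have e1 : dir (φ - σ * e) = dir (φ' - σ * e) := by
    simpa [sub_eq_add_neg] using dir_add_congr hφ (-(σ * e))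
  rw [hφ, e1] at h3 h4
  rw [hφ, dir_add_congr e1] at h5 h6
  rw [hφ, dir_add_congr hφ] at h7 h8
  exact ⟨h1, h2, h3, h4, h5, h6, h7, h8⟩

lemma TypeIIAngle.le {P : Finset Pt} (hP : PennyGP P) {A : Pt} {φ σ e β : ℝ}
    (hσ : σ = 1 ∨ σ = -1) (h : TypeIIAngle P A φ σ e) (hβ : π / 3 < β) (hβπ : β < π)
    (hS : A + dir (φ - σ * β) ∈ P) : e ≤ β := by
  have hpi := Real.pi_pos
  have hlt := h.gt
  refine hP.le_of_path (τ := -σ) (by rcases hσ with rfl | rfl <;> simp) (by linarith) hβ hβπ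
    (O := A) (χ := φ) ?_ ?_
  · rwa [show φ + -σ * β = φ - σ * β by ring]
  · have := h.mem₁
    rwa [show φ + -σ * e = φ - σ * e by ring]

lemma TypeIIAngle.pi_le_add {P : Finset Pt} (hP : PennyGP P) {A : Pt} {φ σ e₁ e₂ : ℝ}
    (hσ : σ = 1 ∨ σ = -1) (h₁ : TypeIIAngle P A φ σ e₁)
    (h₂ : TypeIIAngle P A (φ + σ * (π / 3)) (-σ) e₂)
    (hB₁ : A + dir φ ∈ P) (hB₂ : A + dir (φ + σ * (π / 3)) ∈ P) : π ≤ e₁ + e₂ := by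
  have hpi := Real.pi_pos
  have l1 := h₁.lt
  have l2 := h₁.gt
  have l3 := h₂.lt
  have l4 := h₂.gt
  have hX : A + dir (φ + σ * (π / 3)) + dir φ = A + dir φ + dir (φ + σ * (π / 3)) := by abel
  obtain ⟨a, b, c, ha, hb, hc, hc', ma, -, mc, -⟩ := hP.exists_three_angles hσ h₁.deg₃
    (φ := φ + π) (by rwa [dir_add_pi, ← hX, add_neg_cancel_right])
    (by rwa [show φ + π + σ * (π / 3) = φ + σ * (π / 3) + π by ring, dir_add_pi,
      add_neg_cancel_right])
  have p1 : 4 * π / 3 - a ≤ e₁ := by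
    refine hP.le_of_path (τ := -σ) (by rcases hσ with rfl | rfl <;> simp) (by linarith) l1
      (by linarith) (O := A + dir φ) (χ := φ + σ * (π / 3)) ?_ ?_
    · have := h₁.mem₂
      rwa [show φ + σ * (π / 3) + -σ * e₁ = φ - σ * e₁ + σ * (π / 3) by ring]
    · rwa [show φ + σ * (π / 3) + -σ * (4 * π / 3 - a) = φ + σ * a - σ * π by ring,
        dir_sub_sign_mul_pi hσ, add_right_comm φ]
  have p2 : c - π ≤ e₂ := by
    refine hP.le_of_path hσ (by linarith) l3 (by linarith) (O := A + dir (φ + σ * (π / 3)))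
      (χ := φ) ?_ ?_
    · have := h₂.mem₂
      rwa [show φ + σ * (π / 3) - -σ * e₂ + -σ * (π / 3) = φ + σ * e₂ by ring] at this
    · rwa [hX, show φ + σ * (c - π) = φ + σ * c - σ * π by ring,
        dir_sub_sign_mul_pi hσ, add_right_comm φ]
  linarith

lemma TypeIIAngle.pi_sub_lt {P : Finset Pt} (hP : PennyGP P) {A : Pt} {φ σ β h : ℝ}
    (hσ : σ = 1 ∨ σ = -1) (hβ : TypeIIAngle P A φ σ β) (hB₁ : A + dir φ ∈ P)
    (hB₃ : A + dir (φ - σ * (β + π / 3)) ∈ P)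
    (hZ : A + dir φ + dir (φ - σ * β) + dir (φ - σ * β + σ * (2 * π / 3) - σ * h) ∈ P)
    (h0 : π / 3 < h) (h1 : h < π) : π - β < h := by
  have hpi := Real.pi_pos
  have l1 := hβ.lt
  have l2 := hβ.gt
  have hm1 := hβ.mem₁
  have hm2 := hβ.mem₂
  have hd2 := hβ.deg₂
  have hm3 := hβ.mem₃
  obtain ⟨x, hx⟩ : ∃ x, x = φ - σ * β := ⟨_, rfl⟩
  rw [← hx] at hZ hm1 hm2 hd2
  have hQ : A + dir φ + dir x + dir (x + σ * (2 * π / 3)) = A + dir φ + dir (x + σ * (π / 3)) := by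
    rw [add_assoc _ (dir x), dir_add_dir_two_thirds hσ]
  obtain ⟨a, b, c, ha, hb, hc, hc', ma, -, mc, -⟩ := hP.exists_three_angles hσ hd2
    (φ := x + σ * (π / 3) + π) (by rwa [dir_add_pi, add_neg_cancel_right])
    (by rwa [show x + σ * (π / 3) + π + σ * (π / 3) = x + σ * (2 * π / 3) + π by ring, dir_add_pi,
      ← hQ, add_neg_cancel_right])
  have p1 : c - π ≤ β := by
    refine hP.le_of_path hσ (by linarith) l1 (by linarith) (O := A + dir φ)
      (χ := x + σ * (π / 3)) ?_ ?_
    · rwa [hx, show φ - σ * β + σ * (π / 3) + σ * β = φ + σ * (π / 3) by ring]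
    · rwa [show x + σ * (π / 3) + σ * (c - π) = x + σ * (π / 3) + σ * c - σ * π by ring,
        dir_sub_sign_mul_pi hσ, add_right_comm (x + _)]
  have p1' : c - π ≠ β := by
    intro hcβ
    have hcos : 0 < Real.cos (β / 2) := Real.cos_pos_of_mem_Ioo ⟨by linarith, by linarith⟩
    have hsin : 0 < Real.sin ((β + π / 3) / 2) :=
      Real.sin_pos_of_pos_of_lt_pi (by linarith) (by linarith)
    refine hP.not_collinear_dir (ζ := φ - σ * (β / 2) + σ * (π / 3))
      (a := 2 * Real.cos (β / 2)) (b := -(2 * Real.sin ((β + π / 3) / 2))) hB₁ ?_ ?_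
      (by positivity) (by nlinarith) (by nlinarith)
    · rw [add_right_comm (x + _), ← dir_sub_sign_mul_pi hσ, add_assoc (A + dir φ), dir_add_dir,
        show c = π + β by linarith, hx,
        show (φ - σ * β + σ * (π / 3) - (φ - σ * β + σ * (π / 3) + σ * (π + β) - σ * π)) / 2
          = -(σ * (β / 2)) by ring, Real.cos_neg, cos_mul_sign hσ] at mc
      convert mc using 4
      ring
    · have hB₃' : A + dir (φ - σ * (β + π / 3)) =
          A + dir φ + (dir (φ - σ * (β + π / 3)) - dir φ) := by abel
      rw [hB₃', dir_sub_dir] at hB₃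
      convert hB₃ using 2
      rcases hσ with rfl | rfl
      · rw [neg_smul, ← smul_neg, ← dir_sub_pi]
        congr 2
        · congr 1; ring
        · ring
      · rw [← mul_neg, ← Real.sin_neg]
        congr 2
        · congr 1; ring
        · ring
  have p2 : 4 * π / 3 - a ≤ h := by
    refine hP.le_of_path (τ := -σ) (by rcases hσ with rfl | rfl <;> simp) (by linarith) h0 h1
      (O := A + dir φ + dir x) (χ := x + σ * (2 * π / 3)) ?_ ?_
    · rwa [neg_mul, ← sub_eq_add_neg]
    · rwa [hQ, show x + σ * (2 * π / 3) + -σ * (4 * π / 3 - a) =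
        x + σ * (π / 3) + σ * a - σ * π by ring, dir_sub_sign_mul_pi hσ, add_right_comm (x + _)]
  have := lt_of_le_of_ne p1 p1'
  linarith

/-- The point `A` has exactly four unit-neighbors, in the directions `φ - π / 3`, `φ`, `φ + β` and
`φ + β + π / 3`, and only two pairs of them are 60 degrees apart. -/
structure PairedNeighbors (P : Finset Pt) (A : Pt) (φ β : ℝ) : Prop where
  lt : π / 3 < β
  gt : β < π
  mem₁ : A + dir φ ∈ P
  mem₂ : A + dir (φ - π / 3) ∈ P
  mem₃ : A + dir (φ + β + π / 3) ∈ P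
  mem₄ : A + dir (φ + β) ∈ P
  eq_or : ∀ q ∈ P, dist A q = 1 → q = A + dir φ ∨ q = A + dir (φ - π / 3) ∨
    q = A + dir (φ + β + π / 3) ∨ q = A + dir (φ + β)

lemma PairedNeighbors.rotate {P : Finset Pt} {A : Pt} {φ β : ℝ} (h : PairedNeighbors P A φ β) :
    PairedNeighbors P A (φ + β + π / 3) (4 * π / 3 - β) := by
  have l1 := h.lt
  have l2 := h.gt
  have e1 : dir (φ + β + π / 3 + (4 * π / 3 - β)) = dir (φ - π / 3) := by
    rw [← dir_add_two_pi (φ - π / 3)]; congr 1; ring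
  have e2 : dir (φ + β + π / 3 + (4 * π / 3 - β) + π / 3) = dir φ := by
    rw [← dir_add_two_pi φ]; congr 1; ring
  have e3 : φ + β + π / 3 - π / 3 = φ + β := by ring
  refine ⟨by linarith, by linarith, h.mem₃, e3.symm ▸ h.mem₄, e2 ▸ h.mem₁, e1 ▸ h.mem₂, ?_⟩
  intro q hq hAq
  rw [e1, e2, e3]
  have := h.eq_or q hq hAq
  tauto

lemma PennyGP.exists_pairedNeighbors {P : Finset Pt} (hP : PennyGP P) {A : Pt} (hA : A ∈ P)
    (hdA : deg P A = 4)
    (hpair : ∀ B ∈ P, dist A B = 1 → ∃ C ∈ P, dist A C = 1 ∧ dist B C = 1) :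
    ∃ φ β, PairedNeighbors P A φ β := by
  have hpi := Real.pi_pos
  obtain ⟨φ, hφ0, hφ1⟩ : ∃ φ, A + dir φ ∈ P ∧ A + dir (φ + 1 * (π / 3)) ∈ P := by
    obtain ⟨t, -, -, hm, -, -⟩ := hP.exists_angles A 0 (Or.inl rfl) hdA
    obtain ⟨θ, hθ⟩ : ∃ θ, θ = 0 + 1 * t 0 := ⟨_, rfl⟩
    have hB := hm 0
    rw [← hθ] at hB
    obtain ⟨C, hC, hAC, hBC⟩ := hpair _ hB (dist_add_dir _ _)
    obtain ⟨w, hw0, hw1, hw⟩ := exists_dir (v := C - A) (by rwa [← dist_eq_norm, dist_comm])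
      (φ := θ) (Or.inl rfl)
    have hCw : C = A + dir (θ + 1 * w) := by rw [← hw]; abel
    rw [hCw] at hC hBC
    rw [dist_add_dir_eq_one, show θ - (θ + 1 * w) = -w by ring, Real.cos_neg] at hBC
    rcases hw0.lt_or_eq with h | h
    · rcases eq_of_cos_eq_half h hw1 hBC with rfl | rfl
      · exact ⟨θ, hB, hC⟩
      · refine ⟨_, hC, ?_⟩
        rwa [show θ + 1 * (5 * π / 3) + 1 * (π / 3) = θ + 2 * π by ring, dir_add_two_pi]
    · rw [← h, Real.cos_zero] at hBC
      norm_num at hBC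
  obtain ⟨t, ht0, ht1, hm, hg, hs⟩ := hP.exists_angles A φ (Or.inl rfl) hdA
  have g01 := (hg 0 1 (by decide)).1
  have g12 := (hg 1 2 (by decide)).1
  have g23 := (hg 2 3 (by decide)).1
  have g03 := (hg 0 3 (by decide)).2
  have p0 := ht0 0
  have e0 : t 0 = 0 := by
    obtain ⟨i, hi⟩ := hs _ hφ0 (dist_add_dir _ _)
    have hi' : dir (φ + 1 * t i) = dir (φ + 1 * 0) := by simpa using hi.symm
    have := eq_of_dir_eq (Or.inl rfl) hi' (by linarith [ht1 i]) (by linarith [ht0 i])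
    fin_cases i <;> simp at this <;> linarith
  have e1 : t 1 = π / 3 := by
    obtain ⟨i, hi⟩ := hs _ hφ1 (dist_add_dir _ _)
    have hi' : dir (φ + 1 * t i) = dir (φ + 1 * (π / 3)) := by simpa using hi.symm
    have := eq_of_dir_eq (Or.inl rfl) hi' (by linarith [ht1 i]) (by linarith [ht0 i])
    fin_cases i <;> simp at this <;> linarith
  have hanti (i j : Fin 4) : t j ≠ t i + π := by
    have := hP.not_antipodal hA (hm i) (hm j)
    intro h
    exact this (by rw [h]; ring)
  have a03 := hanti 0 3
  have a13 := hanti 1 3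
  have a12 := hanti 1 2
  have a02 := hanti 0 2
  have partner (i : Fin 4) : ∃ j, Real.cos (t i - t j) = 1 / 2 := by
    obtain ⟨C, hC, hAC, hBC⟩ := hpair _ (hm i) (dist_add_dir _ _)
    obtain ⟨j, rfl⟩ := hs C hC hAC
    refine ⟨j, ?_⟩
    rw [dist_add_dir_eq_one] at hBC
    rwa [show φ + 1 * t i - (φ + 1 * t j) = t i - t j by ring] at hBC
  have e3 : t 3 = t 2 + π / 3 := by
    have eq_of_cos : Real.cos (t 3 - t 2) = 1 / 2 → t 3 = t 2 + π / 3 := fun h => by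
      rcases eq_of_cos_eq_half (by linarith) (by linarith) h with h | h <;> linarith
    obtain ⟨j, hj⟩ := partner 2
    fin_cases j <;> simp only [Fin.zero_eta, Fin.mk_one, Fin.reduceFinMk] at hj
    · rcases eq_of_cos_eq_half (by linarith) (by linarith) hj with h | h <;> linarith
    · have e2 : t 2 = 2 * π / 3 := by
        rcases eq_of_cos_eq_half (by linarith) (by linarith) hj with h | h <;> linarith
      obtain ⟨k, hk⟩ := partner 3
      fin_cases k <;> simp only [Fin.zero_eta, Fin.mk_one, Fin.reduceFinMk] at hk
      · rcases eq_of_cos_eq_half (by linarith) (by linarith) hk with h | h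
        · linarith
        · exact absurd (show t 3 = t 2 + π by linarith) (hanti 2 3)
      · rcases eq_of_cos_eq_half (by linarith) (by linarith) hk with h | h <;> linarith
      · exact eq_of_cos hk
      · norm_num at hk
    · norm_num at hj
    · rw [← Real.cos_neg, neg_sub] at hj
      exact eq_of_cos hj
  refine ⟨φ + π / 3, t 2 - π / 3, ?_⟩
  have m0 := hm 0
  have m1 := hm 1
  have m2 := hm 2
  have m3 := hm 3
  have f0 : φ + π / 3 - π / 3 = φ + 1 * t 0 := by rw [e0]; ring
  have f1 : φ + π / 3 = φ + 1 * t 1 := by rw [e1]; ring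
  have f2 : φ + π / 3 + (t 2 - π / 3) = φ + 1 * t 2 := by ring
  have f3 : φ + π / 3 + (t 2 - π / 3) + π / 3 = φ + 1 * t 3 := by rw [e3]; ring
  have l1 : 2 * π / 3 < t 2 := lt_of_le_of_ne (by linarith) fun h => a03 (by linarith)
  have l2 : t 2 < 4 * π / 3 := lt_of_le_of_ne (by linarith) fun h => a12 (by linarith)
  refine ⟨by linarith, by linarith, f1 ▸ m1, f0 ▸ m0, f3 ▸ m3, f2 ▸ m2, fun q hq hAq => ?_⟩
  rw [f3, f2, f0, f1]
  obtain ⟨i, hi⟩ := hs q hq hAq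
  fin_cases i
  · exact Or.inr (Or.inl hi)
  · exact Or.inl hi
  · exact Or.inr (Or.inr (Or.inr hi))
  · exact Or.inr (Or.inr (Or.inl hi))

lemma PennyGP.add_lt_of_typeIIAngle {P : Finset Pt} (hP : PennyGP P) {A : Pt} {φ β e₁ e₄ : ℝ}
    (hN : PairedNeighbors P A φ β) (h₁ : TypeIIAngle P A φ (-1) e₁)
    (h₄ : TypeIIAngle P A (φ + β) 1 e₄) : e₁ + e₄ < β + π / 3 := by
  have hpi := Real.pi_pos
  by_contra! hsum
  have le₁ := h₁.le hP (Or.inr rfl) hN.lt hN.gt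
    (by rw [neg_one_mul, sub_neg_eq_add]; exact hN.mem₄)
  have le₄ := h₄.le hP (Or.inl rfl) hN.lt hN.gt
    (by rw [one_mul, add_sub_cancel_right]; exact hN.mem₁)
  obtain ⟨E₁, E₄⟩ := hP.eq_of_pentagon hN.gt le₁ le₄ h₁.gt h₄.gt hsum
    (by simpa using h₁.mem₁) (by simpa using h₄.mem₁)
  rw [E₁] at h₁
  rw [E₄] at h₄
  have l1 := h₁.lt
  have l2 := h₁.gt
  have hQ : A + dir φ + dir (φ + β) = A + dir (φ + β) + dir φ := by abel
  have hB₁ := hN.mem₁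
  have hB₄ := hN.mem₄
  have hC := h₁.mem₂
  have hC' := h₄.mem₂
  rw [show φ - -1 * β + -1 * (π / 3) = φ + β + -1 * (π / 3) by ring,
    ← dir_add_dir_two_thirds (Or.inr rfl), ← add_assoc] at hC
  rw [show φ + β - 1 * β + 1 * (π / 3) = φ + 1 * (π / 3) by ring,
    ← dir_add_dir_two_thirds (Or.inl rfl), ← add_assoc, ← hQ, one_mul] at hC'
  obtain ⟨a, b, c, ha, hb, hc, hc', -, -, mc, hall⟩ := hP.exists_three_angles (Or.inl rfl)
    (Y := A + dir φ + dir (φ + β)) (by simpa using h₁.deg₁) hC'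
    (by rwa [show φ + 2 * π / 3 + 1 * (π / 3) = φ + π by ring, dir_add_pi, hQ,
      add_neg_cancel_right])
  have mem {w : ℝ} (hw : A + dir φ + dir (φ + β) + dir (φ + 2 * π / 3 + 1 * w) ∈ P)
      (h0 : 2 * π / 3 < w) (h1 : w < 5 * π / 3) : w = a ∨ w = b ∨ w = c := by
    have inj {z : ℝ} (h : dir (φ + 2 * π / 3 + 1 * w) = dir (φ + 2 * π / 3 + 1 * z))
        (h2 : 0 ≤ z) (h3 : z < 2 * π) : w = z :=
      eq_of_dir_eq (Or.inl rfl) h (by linarith) (by linarith)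
    rcases hall _ hw (dist_add_dir _ _) with h | h | h | h | h <;> rw [add_right_inj] at h
    · have := inj (z := 0) (by simpa using h) le_rfl (by linarith)
      linarith
    · have := inj h (by linarith) (by linarith)
      linarith
    · exact Or.inl (inj h (by linarith) (by linarith))
    · exact Or.inr (Or.inl (inj h (by linarith) (by linarith)))
    · exact Or.inr (Or.inr (inj h (by linarith) (by linarith)))
  have hw₁ := mem (w := π / 3 + β)
    (by rwa [show φ + 2 * π / 3 + 1 * (π / 3 + β) = φ + β + π by ring, dir_add_pi,
      add_neg_cancel_right]) (by linarith) (by linarith)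
  have hw₂ := mem (w := 2 * π / 3 + β)
    (by rwa [show φ + 2 * π / 3 + 1 * (2 * π / 3 + β) = φ + β + -1 * (2 * π / 3) + 2 * π by ring,
      dir_add_two_pi]) (by linarith) (by linarith)
  have hb' : b = 2 * π / 3 + β := by
    rcases hw₁ with h | h | h <;> rcases hw₂ with h' | h' | h' <;> linarith
  have hcle : c ≤ π + β := by
    by_contra! hlt
    have := h₁.pi_sub_lt hP (h := c - b) (Or.inr rfl) hB₁
      (by rw [neg_one_mul, sub_neg_eq_add, ← add_assoc]; exact hN.mem₃)
      (by
        rw [← dir_add_two_pi (φ - -1 * β + _ - _)]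
        convert mc using 3
        · rw [neg_one_mul, sub_neg_eq_add]
        · rw [hb']; ring) (by linarith) (by linarith)
    linarith
  have := h₄.pi_sub_lt hP (h := π - β) (Or.inl rfl) hB₄
    (by rw [show φ + β - 1 * (β + π / 3) = φ - π / 3 by ring]; exact hN.mem₂)
    (by
      rw [show φ + β - 1 * β = φ by ring, ← hQ,
        ← dir_add_two_pi (φ + _ - _)]
      convert mc using 3
      rw [show c = π + β by linarith]; ring) (by linarith) (by linarith)
  linarith

lemma PairedNeighbors.false_of_typeII {P : Finset Pt} (hP : PennyGP P) {A : Pt} (hA : A ∈ P)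
    (hdA : deg P A = 4) (hap : ¬ InApricot P A) {φ β : ℝ} (h : PairedNeighbors P A φ β)
    (hB : ∀ B ∈ P, dist A B = 1 → IsTypeII P A B) : False := by
  have exists_add_lt {φ β : ℝ} (h : PairedNeighbors P A φ β) : ∃ e₁ e₄,
      TypeIIAngle P A φ (-1) e₁ ∧ TypeIIAngle P A (φ + β) 1 e₄ ∧ e₁ + e₄ < β + π / 3 := by
    have hpi := Real.pi_pos
    have l1 := h.lt
    have l2 := h.gt
    have c1 : Real.cos β < 1 / 2 := by
      rw [← Real.cos_pi_div_three]
      exact Real.cos_lt_cos_of_nonneg_of_le_pi (by linarith) l2.le l1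
    have c2 : Real.cos (β + π / 3) < 0 :=
      Real.cos_neg_of_pi_div_two_lt_of_lt (by linarith) (by linarith)
    obtain ⟨e₁, he₁⟩ := hP.exists_typeIIAngle hA hdA hap (Or.inr rfl) h.mem₁ (fun q hq hAq hBq => by
      rcases h.eq_or q hq hAq with rfl | rfl | rfl | rfl
      · simp at hBq
      · congr 2; ring
      · rw [dist_add_dir_eq_one, ← Real.cos_neg, show -(φ - (φ + β + π / 3)) = β + π / 3 by ring]
          at hBq
        linarith
      · rw [dist_add_dir_eq_one, ← Real.cos_neg, show -(φ - (φ + β)) = β by ring] at hBq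
        linarith) (hB _ h.mem₁ (dist_add_dir _ _))
    obtain ⟨e₄, he₄⟩ := hP.exists_typeIIAngle hA hdA hap (Or.inl rfl) h.mem₄ (fun q hq hAq hBq => by
      rcases h.eq_or q hq hAq with rfl | rfl | rfl | rfl
      · rw [dist_add_dir_eq_one, show φ + β - φ = β by ring] at hBq
        linarith
      · rw [dist_add_dir_eq_one, show φ + β - (φ - π / 3) = β + π / 3 by ring] at hBq
        linarith
      · congr 2; ring
      · simp at hBq) (hB _ h.mem₄ (dist_add_dir _ _))
    exact ⟨e₁, e₄, he₁, he₄, hP.add_lt_of_typeIIAngle h he₁ he₄⟩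
  obtain ⟨e₁, e₄, h₁, h₄, hlt⟩ := exists_add_lt h
  obtain ⟨e₃, e₂, h₃, h₂, hlt'⟩ := exists_add_lt h.rotate
  have s1 := h₄.pi_le_add hP (Or.inl rfl) (e₂ := e₃) (by rwa [one_mul]) h.mem₄
    (by rw [one_mul]; exact h.mem₃)
  have s2 := h₂.pi_le_add hP (Or.inl rfl) (e₂ := e₁) (h₁.congr (by
      rw [← dir_add_two_pi φ]; congr 1; ring)) h.rotate.mem₄
    (by rw [one_mul]; exact h.rotate.mem₃)
  linarith

/-- The four edges at a vertex of degree 4 not belonging to an apricot cannot all be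
of Type II: it is impossible that every unit-neighbor `B` of `A` has degree 5, is
popular, and has its five unit-neighbors, listed in cyclic angular order around `B`
(in a suitable rotational direction) as `C₁, C₂, C₃, C₄, A`, satisfying
`dist C₁ C₂ = dist C₃ C₄ = dist C₄ A = 1`. -/
theorem not_all_edges_type_II (P : Finset Pt) (hP : PennyGP P)
    (A : Pt) (hA : A ∈ P) (hdA : deg P A = 4) (hap : ¬ InApricot P A) :
    ¬ ∀ B ∈ P, dist A B = 1 →
      (deg P B = 5 ∧ ¬ Unpopular P B ∧
        ∃ C₁ ∈ P, ∃ C₂ ∈ P, ∃ C₃ ∈ P, ∃ C₄ ∈ P,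
          List.Pairwise (· ≠ ·) [C₁, C₂, C₃, C₄, A] ∧
          dist B C₁ = 1 ∧ dist B C₂ = 1 ∧ dist B C₃ = 1 ∧ dist B C₄ = 1 ∧
          (AngOrder B [C₁, C₂, C₃, C₄, A] ∨ AngOrder B [A, C₄, C₃, C₂, C₁]) ∧
          dist C₁ C₂ = 1 ∧ dist C₃ C₄ = 1 ∧ dist C₄ A = 1) := by
  intro hall
  obtain ⟨φ, β, h⟩ := hP.exists_pairedNeighbors hA hdA fun B hB hAB => by
    obtain ⟨-, -, C₁, -, C₂, -, C₃, -, C₄, hC₄, -, -, -, -, hBC₄, -, -, -, hC₄A⟩ := hall B hB hAB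
    exact ⟨C₄, hC₄, by rwa [dist_comm], hBC₄⟩
  exact h.false_of_typeII hP hA hdA hap hall
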